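/- arXiv:2009.04230 — 2 statements merged into one kernel-verified Lean document; each statement's English description precedes it below -/
import Mathlib

section
/- Let G be a finite group, θ : G → G an involutive automorphism, and H ⊆ G a θ-stable subgroup (θ(H) = H). If for every x ∈ G there exist h₁, h₂ ∈ H such that h₁ x⁻¹ h₂ = θ(x), then (G,H) is a Gelfand pair. -/
open scoped Classical TensorProduct

noncomputable section

namespace GK

variable {G : Type} [Group G]

/-- A complex representation is irreducible if it is nonzero and has no invariant subspaces
other than `⊥` and `⊤`. -/
def IsIrred {V : Type} [AddCommGroup V] [Module ℂ V] (π : Representation ℂ G V) : Prop :=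
  (⊥ : Submodule ℂ V) ≠ ⊤ ∧
    ∀ W : Submodule ℂ V, (∀ (g : G), ∀ v ∈ W, π g v ∈ W) → W = ⊥ ∨ W = ⊤

/-- The subspace `π^H` of vectors invariant under a subgroup `H`. -/
def invariantsOf {V : Type} [AddCommGroup V] [Module ℂ V] (π : Representation ℂ G V)
    (H : Subgroup G) : Submodule ℂ V where
  carrier := {v | ∀ h ∈ H, π h v = v}
  add_mem' := by
    intro a b ha hb h hh
    simp [map_add, ha h hh, hb h hh]
  zero_mem' := by
    intro h hh
    simp
  smul_mem' := by
    intro c v hv h hh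
    simp [map_smul, hv h hh]

/-- `(G, H)` is a Gelfand pair: every irreducible complex representation of `G` has at most
one-dimensional space of `H`-invariant vectors. -/
def IsGelfandPair (G : Type) [Group G] (H : Subgroup G) : Prop :=
  ∀ (V : Type) [AddCommGroup V] [Module ℂ V] [FiniteDimensional ℂ V]
    (π : Representation ℂ G V), IsIrred π →
      Module.finrank ℂ (invariantsOf π H) ≤ 1

/-- Isomorphism of representations. -/
def RepIso {V W : Type} [AddCommGroup V] [Module ℂ V] [AddCommGroup W] [Module ℂ W]
    (π : Representation ℂ G V) (τ : Representation ℂ G W) : Prop :=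
  ∃ e : V ≃ₗ[ℂ] W, ∀ (g : G) (v : V), e (π g v) = τ g (e v)

/-- `π ∘ θ ≅ π*`: the θ-twist of `π` is isomorphic to the dual (contragredient)
representation of `π`. -/
def ConjThetaIsoDual {V : Type} [AddCommGroup V] [Module ℂ V] (θ : G ≃* G)
    (π : Representation ℂ G V) : Prop :=
  RepIso (MonoidHom.comp π θ.toMonoidHom) π.dual

/-- `π` possesses a nonzero symmetric bilinear form `B` with
`B(π(g)v, w) = B(v, π(θ(g⁻¹))w)`. -/
def HasSymForm {V : Type} [AddCommGroup V] [Module ℂ V] (θ : G ≃* G)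
    (π : Representation ℂ G V) : Prop :=
  ∃ B : V →ₗ[ℂ] V →ₗ[ℂ] ℂ, B ≠ 0 ∧ (∀ v w, B v w = B w v) ∧
    ∀ (g : G) (v w : V), B (π g v) w = B v (π (θ g⁻¹) w)

/-- `π` possesses a nonzero antisymmetric bilinear form `B` with
`B(π(g)v, w) = B(v, π(θ(g⁻¹))w)`. -/
def HasAltForm {V : Type} [AddCommGroup V] [Module ℂ V] (θ : G ≃* G)
    (π : Representation ℂ G V) : Prop :=
  ∃ B : V →ₗ[ℂ] V →ₗ[ℂ] ℂ, B ≠ 0 ∧ (∀ v w, B v w = - B w v) ∧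
    ∀ (g : G) (v w : V), B (π g v) w = B v (π (θ g⁻¹) w)

/-- The twisted Frobenius–Schur indicator `ε_θ(π)`: `1` if `π` has a nonzero symmetric
θ-twisted invariant bilinear form, `-1` if it has a nonzero antisymmetric one, and `0`
otherwise (for irreducible `π` this last case is exactly `π ∘ θ ≇ π*`). -/
def eps {V : Type} [AddCommGroup V] [Module ℂ V] (θ : G ≃* G)
    (π : Representation ℂ G V) : ℤ :=
  if HasSymForm θ π then 1 else if HasAltForm θ π then -1 else 0

end GK

namespace GK

section HeckeOperators

variable {G : Type} [Group G] [Fintype G] {V : Type} [AddCommGroup V] [Module ℂ V]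
  (π : Representation ℂ G V) (H : Subgroup G)

/-- The unnormalized averaging operator `∑ h ∈ H, π h`. -/
def sumOver : Module.End ℂ V := ∑ h : H, π h

/-- The Hecke operator attached to the double coset of `x`. -/
def hecke (x : G) : Module.End ℂ V := sumOver π H * π x * sumOver π H

variable {H}

lemma map_mul_sumOver {h : G} (hh : h ∈ H) : π h * sumOver π H = sumOver π H := by
  simp only [sumOver, Finset.mul_sum, ← map_mul]
  exact Fintype.sum_equiv (Equiv.mulLeft (⟨h, hh⟩ : H)) _ _ fun _ => rfl

lemma sumOver_mul_map {h : G} (hh : h ∈ H) : sumOver π H * π h = sumOver π H := by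
  simp only [sumOver, Finset.sum_mul, ← map_mul]
  exact Fintype.sum_equiv (Equiv.mulRight (⟨h, hh⟩ : H)) _ _ fun _ => rfl

lemma sumOver_mem (v : V) : sumOver π H v ∈ invariantsOf π H := fun h hh => by
  rw [← Module.End.mul_apply, map_mul_sumOver π hh]

lemma sumOver_apply_of_mem {v : V} (hv : v ∈ invariantsOf π H) :
    sumOver π H v = (Fintype.card H : ℂ) • v := by
  have key : ∀ h : H, π h v = v := fun h => hv h h.2
  simp [sumOver, LinearMap.sum_apply, key, Nat.cast_smul_eq_nsmul]

lemma sumOver_mul_self :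
    sumOver π H * sumOver π H = (Fintype.card H : ℂ) • sumOver π H :=
  LinearMap.ext fun v => sumOver_apply_of_mem π (sumOver_mem π v)

lemma hecke_apply_of_mem (x : G) {v : V} (hv : v ∈ invariantsOf π H) :
    hecke π H x v = (Fintype.card H : ℂ) • sumOver π H (π x v) := by
  simp [hecke, sumOver_apply_of_mem π hv]

lemma hecke_mem (x : G) (v : V) : hecke π H x v ∈ invariantsOf π H :=
  sumOver_mem π _

lemma hecke_mul_mul {a b : G} (ha : a ∈ H) (hb : b ∈ H) (x : G) :
    hecke π H (a * x * b) = hecke π H x := by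
  calc hecke π H (a * x * b)
      = (sumOver π H * π a) * π x * (π b * sumOver π H) := by
        simp only [hecke, map_mul, mul_assoc]
    _ = hecke π H x := by
        rw [sumOver_mul_map π ha, map_mul_sumOver π hb, hecke]

lemma hecke_mul_hecke (x y : G) :
    hecke π H x * hecke π H y =
      (Fintype.card H : ℂ) • ∑ h : H, hecke π H (x * h * y) := by
  calc hecke π H x * hecke π H y
      = sumOver π H * π x * (sumOver π H * sumOver π H) * π y * sumOver π H := by
        simp only [hecke, mul_assoc]
    _ = (Fintype.card H : ℂ) •
          (sumOver π H * π x * (∑ h : H, π h) * π y * sumOver π H) := by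
        rw [sumOver_mul_self]
        simp only [mul_smul_comm, smul_mul_assoc]
        rfl
    _ = _ := by
        simp only [hecke, map_mul, Finset.mul_sum, Finset.sum_mul, mul_assoc]

/-- Gelfand's trick: `x ↦ θ x⁻¹` is an anti-automorphism preserving double cosets. -/
lemma hecke_commute (θ : G ≃* G) (hH : H.map θ.toMonoidHom = H)
    (hGK : ∀ x : G, ∃ h₁ ∈ H, ∃ h₂ ∈ H, h₁ * x⁻¹ * h₂ = θ x) (x y : G) :
    Commute (hecke π H x) (hecke π H y) := by
  have hecke_anti : ∀ g, hecke π H (θ g⁻¹) = hecke π H g := fun g => by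
    obtain ⟨a, ha, b, hb, hab⟩ := hGK g⁻¹
    rw [← hab, hecke_mul_mul π ha hb, inv_inv]
  let e : H ≃ H := (Equiv.inv H).trans
    ((H.equivMapOfInjective θ.toMonoidHom θ.injective).trans
      (MulEquiv.subgroupCongr hH)).toEquiv
  have he : ∀ h : H, (e h : G) = θ (h : G)⁻¹ := fun h => rfl
  calc hecke π H x * hecke π H y
      = (Fintype.card H : ℂ) • ∑ h : H, hecke π H (θ y⁻¹ * h * θ x⁻¹) := by
        rw [hecke_mul_hecke]
        congr 1
        refine Fintype.sum_equiv e _ _ fun h => ?_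
        rw [← hecke_anti, he]
        simp only [mul_inv_rev, map_mul, mul_assoc]
    _ = hecke π H y * hecke π H x := by
        rw [← hecke_mul_hecke, hecke_anti, hecke_anti]

lemma IsIrred.invariantsOf_le {π : Representation ℂ G V} (hπ : IsIrred π) {w : V}
    (hw : w ∈ invariantsOf π H) (hw0 : w ≠ 0) {U : Submodule ℂ V}
    (hU : ∀ x, hecke π H x w ∈ U) : invariantsOf π H ≤ U := by
  have hcard : (Fintype.card H : ℂ) ≠ 0 := Nat.cast_ne_zero.2 Fintype.card_ne_zero
  have hspan : Submodule.span ℂ (Set.range fun g => π g w) = ⊤ := by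
    refine (hπ.2 _ fun g => ?_).resolve_left fun hbot => hw0 ?_
    · suffices h : Submodule.span ℂ (Set.range fun g => π g w) ≤
          (Submodule.span ℂ (Set.range fun g => π g w)).comap (π g) from fun v hv => h hv
      rw [Submodule.span_le]
      rintro _ ⟨k, rfl⟩
      exact Submodule.subset_span ⟨g * k, by simp⟩
    · rw [← Submodule.mem_bot ℂ, ← hbot]
      exact Submodule.subset_span ⟨1, by simp⟩
  have hle : ⊤ ≤ U.comap (sumOver π H) := by
    rw [← hspan, Submodule.span_le]
    rintro _ ⟨g, rfl⟩
    have := hU g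
    rw [hecke_apply_of_mem π g hw] at this
    exact (U.smul_mem_iff hcard).1 this
  intro v hv
  have hSv : sumOver π H v ∈ U := hle (Submodule.mem_top (x := v))
  rw [sumOver_apply_of_mem π hv] at hSv
  exact (U.smul_mem_iff hcard).1 hSv

lemma IsIrred.finrank_invariantsOf_le_one [FiniteDimensional ℂ V]
    {π : Representation ℂ G V} (hπ : IsIrred π)
    (hcomm : ∀ x y, Commute (hecke π H x) (hecke π H y)) :
    Module.finrank ℂ (invariantsOf π H) ≤ 1 := by
  rcases subsingleton_or_nontrivial (invariantsOf π H) with _ | _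
  · simp [Module.finrank_zero_of_subsingleton]
  have hscalar : ∀ x, ∃ c : ℂ, ∀ v ∈ invariantsOf π H, hecke π H x v = c • v := by
    intro x
    obtain ⟨c, hc⟩ := Module.End.exists_eigenvalue
      ((hecke π H x).restrict (p := invariantsOf π H) fun v _ => hecke_mem π x v)
    obtain ⟨w, hw⟩ := hc.exists_hasEigenvector
    have hcw : hecke π H x (w : V) = c • (w : V) := congrArg Subtype.val hw.apply_eq_smul
    refine ⟨c, fun v hv => Module.End.mem_eigenspace_iff.1
      (hπ.invariantsOf_le w.2 (by simpa using hw.2) (fun y => ?_) hv)⟩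
    rw [Module.End.mem_eigenspace_iff, ← Module.End.mul_apply, (hcomm x y).eq,
      Module.End.mul_apply, hcw, map_smul]
  choose c hc using hscalar
  obtain ⟨w, hw0⟩ := exists_ne (0 : invariantsOf π H)
  have hle : invariantsOf π H ≤ Submodule.span ℂ {(w : V)} :=
    hπ.invariantsOf_le w.2 (by simpa using hw0) fun y =>
      hc y w w.2 ▸ Submodule.smul_mem _ _ (Submodule.mem_span_singleton_self _)
  refine finrank_le_one w fun v => ?_
  obtain ⟨a, ha⟩ := Submodule.mem_span_singleton.1 (hle v.2)
  exact ⟨a, Subtype.ext ha⟩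

end HeckeOperators

end GK

/-- The Gelfand–Kazhdan double coset condition implies that `(G,H)` is a
Gelfand pair. -/
theorem gelfand_of_gelfand_kazhdan {G : Type} [Group G] [Fintype G]
    (θ : G ≃* G) (hθ : ∀ g : G, θ (θ g) = g)
    (H : Subgroup G) (hH : H.map θ.toMonoidHom = H)
    (hGK : ∀ x : G, ∃ h₁ ∈ H, ∃ h₂ ∈ H, h₁ * x⁻¹ * h₂ = θ x) :
    GK.IsGelfandPair G H := by
  intro V _ _ _ π hπ
  exact hπ.finrank_invariantsOf_le_one (GK.hecke_commute π θ hH hGK)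
end
end

section
/- Let G be a finite group, θ : G → G an involutive automorphism, and H ⊆ G a θ-stable subgroup (θ(H) = H). If for every g ∈ G there exist h₁, h₂ ∈ H such that h₁ g⁻¹ h₂ = θ(g), then (G,H) is a Gelfand pair and every H-distinguished irreducible complex representation π of G satisfies π ∘ θ ≅ π*. -/
open scoped Classical TensorProduct

noncomputable section

namespace GK

variable {G : Type} [Group G] {V : Type} [AddCommGroup V] [Module ℂ V]
  {π : Representation ℂ G V}

/-- In an irreducible representation, the orbit of a nonzero vector spans. -/
theorem IsIrred.span_orbit_eq_top (hπ : IsIrred π) {v : V} (hv : v ≠ 0) :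
    Submodule.span ℂ (Set.range fun g => π g v) = ⊤ := by
  refine (hπ.2 _ fun g w hw => ?_).resolve_left fun h => hv ?_
  · induction hw using Submodule.span_induction with
    | mem x hx =>
      obtain ⟨k, rfl⟩ := hx
      exact Submodule.subset_span ⟨g * k, by simp⟩
    | zero => simp
    | add x y _ _ hx hy => simpa using add_mem hx hy
    | smul c x _ hx => simpa using Submodule.smul_mem _ c hx
  · have hmem : v ∈ Submodule.span ℂ (Set.range fun g => π g v) :=
      Submodule.subset_span ⟨1, by simp⟩
    simpa [h] using hmem

/-- A nonzero `H`-invariant vector is detected by an `H`-invariant functional. -/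
theorem exists_invariant_functional [Finite G] (H : Subgroup G) {v : V}
    (hvH : v ∈ invariantsOf π H) (hv : v ≠ 0) :
    ∃ l : Module.Dual ℂ V, (∀ h ∈ H, ∀ u, l (π h u) = l u) ∧ l v ≠ 0 := by
  have := Fintype.ofFinite H
  obtain ⟨l, hl⟩ : ∃ l : Module.Dual ℂ V, l v ≠ 0 := by
    by_contra! h
    exact hv ((Module.forall_dual_apply_eq_zero_iff ℂ v).1 h)
  refine ⟨∑ h : H, l ∘ₗ π h, fun k hk u => ?_, ?_⟩
  · simp only [LinearMap.sum_apply, LinearMap.comp_apply, ← Module.End.mul_apply, ← map_mul]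
    exact Fintype.sum_equiv (Equiv.mulRight (⟨k, hk⟩ : H)) _ _ fun _ => rfl
  · have hfix : ∀ h : H, π h v = v := fun h => hvH h h.2
    simp [hfix, hl]

/-- Under the Gelfand–Kazhdan condition, matrix coefficients between `H`-invariants are
invariant under `g ↦ θ g⁻¹`. -/
theorem matrixCoeff_inv_eq {θ : G ≃* G} {H : Subgroup G}
    (hGK : ∀ g : G, ∃ h₁ ∈ H, ∃ h₂ ∈ H, h₁ * g⁻¹ * h₂ = θ g) {v : V}
    (hvH : v ∈ invariantsOf π H) {l : Module.Dual ℂ V}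
    (hl : ∀ h ∈ H, ∀ u, l (π h u) = l u) (g : G) : l (π (θ g) v) = l (π g⁻¹ v) := by
  obtain ⟨h₁, hh₁, h₂, hh₂, h⟩ := hGK g
  rw [← h, map_mul, map_mul, Module.End.mul_apply, Module.End.mul_apply, hl h₁ hh₁, hvH h₂ hh₂]

/-- Under the Gelfand–Kazhdan condition, a nonzero `H`-invariant vector `v` can be sent to any
`H`-invariant functional by an intertwiner from `π ∘ θ` to `π*`. -/
theorem exists_intertwiner_dual {θ : G ≃* G} {H : Subgroup G}
    (hGK : ∀ g : G, ∃ h₁ ∈ H, ∃ h₂ ∈ H, h₁ * g⁻¹ * h₂ = θ g) (hπ : IsIrred π) {v : V}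
    (hvH : v ∈ invariantsOf π H) (hv : v ≠ 0) {l : Module.Dual ℂ V}
    (hl : ∀ h ∈ H, ∀ u, l (π h u) = l u) :
    ∃ T : V →ₗ[ℂ] Module.Dual ℂ V, T v = l ∧ ∀ g u, T (π (θ g) u) = π.dual g (T u) := by
  let a := Finsupp.linearCombination ℂ fun x => π (θ x) v
  let b := Finsupp.linearCombination ℂ fun x => π.dual x l
  have ha : Function.Surjective a := by
    rw [← LinearMap.range_eq_top, Finsupp.range_linearCombination, ← hπ.span_orbit_eq_top hv]
    exact congrArg _ (θ.surjective.range_comp fun g => π g v)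
  have hab : LinearMap.ker a ≤ LinearMap.ker b := by
    intro c hc
    rw [LinearMap.mem_ker] at hc ⊢
    refine LinearMap.ext_on_range (hπ.span_orbit_eq_top hv) fun y => ?_
    have key : b c (π y v) = l (π (θ y⁻¹) (a c)) := by
      simp only [a, b, Finsupp.linearCombination_apply, Finsupp.sum, map_sum, map_smul,
        LinearMap.sum_apply, LinearMap.smul_apply]
      refine Finset.sum_congr rfl fun x _ => congrArg _ ?_
      have h := matrixCoeff_inv_eq hGK hvH hl (y⁻¹ * x)
      rw [mul_inv_rev, inv_inv, map_mul, map_mul, map_mul] at h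
      exact h.symm
    simp [key, hc]
  let T := (LinearMap.ker a).liftQ b hab ∘ₗ (a.quotKerEquivOfSurjective ha).symm.toLinearMap
  have hT : ∀ c, T (a c) = b c := fun c => by
    have : (a.quotKerEquivOfSurjective ha).symm (a c) = (LinearMap.ker a).mkQ c :=
      (LinearEquiv.symm_apply_eq _).2 rfl
    simp [T, this]
  have hTx : ∀ x, T (π (θ x) v) = π.dual x l := fun x => by
    simpa [a, b] using hT (Finsupp.single x 1)
  refine ⟨T, by simpa only [map_one, Module.End.one_apply] using hTx 1, fun g => LinearMap.congr_fun
    (f := T ∘ₗ π (θ g)) (g := π.dual g ∘ₗ T) ?_⟩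
  refine LinearMap.ext_on_range (hπ.span_orbit_eq_top hv) fun y => ?_
  obtain ⟨x, rfl⟩ := θ.surjective y
  have h := hTx (g * x)
  simp only [map_mul, Module.End.mul_apply] at h
  simp only [LinearMap.comp_apply, h, hTx]

/-- A nonzero intertwiner from `π ∘ θ` to `π*` is bijective. -/
theorem bijective_intertwiner_dual [FiniteDimensional ℂ V] {θ : G ≃* G} (hπ : IsIrred π)
    {T : V →ₗ[ℂ] Module.Dual ℂ V} (hT : ∀ g u, T (π (θ g) u) = π.dual g (T u)) (hT0 : T ≠ 0) :
    Function.Bijective T := by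
  have hker : LinearMap.ker T = ⊥ := by
    refine (hπ.2 _ fun g u hu => ?_).resolve_right fun h => hT0 (LinearMap.ker_eq_top.1 h)
    obtain ⟨x, rfl⟩ := θ.surjective g
    rw [LinearMap.mem_ker] at hu ⊢
    rw [hT, hu, map_zero]
  have hinj := LinearMap.ker_eq_bot.1 hker
  exact ⟨hinj, (LinearMap.injective_iff_surjective_of_finrank_eq_finrank
    (Subspace.dual_finrank_eq).symm).1 hinj⟩

/-- **Schur's lemma**: intertwiners from `π ∘ θ` to `π*` are unique up to scalars. -/
theorem exists_eq_smul_intertwiner_dual [FiniteDimensional ℂ V] {θ : G ≃* G} (hπ : IsIrred π)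
    {S T : V →ₗ[ℂ] Module.Dual ℂ V} (hS : ∀ g u, S (π (θ g) u) = π.dual g (S u))
    (hT : ∀ g u, T (π (θ g) u) = π.dual g (T u)) (hT0 : T ≠ 0) : ∃ c : ℂ, S = c • T := by
  let e := LinearEquiv.ofBijective T (bijective_intertwiner_dual hπ hT hT0)
  have : Nontrivial V := by
    obtain ⟨u, hu⟩ := DFunLike.ne_iff.1 hT0
    exact ⟨u, 0, fun h => hu (by simp [h])⟩
  obtain ⟨c, hc⟩ := Module.End.exists_eigenvalue (e.symm.toLinearMap ∘ₗ S)
  obtain ⟨u, hu⟩ := hc.exists_hasEigenvector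
  refine ⟨c, ?_⟩
  by_contra hne
  have hinj := (bijective_intertwiner_dual (θ := θ) (T := S - c • T) hπ
    (fun g u => by simp only [LinearMap.sub_apply, LinearMap.smul_apply, hS, hT, map_sub, map_smul])
    (sub_ne_zero.2 hne)).1
  refine hu.2 (hinj ?_)
  have h : e.symm (S u) = c • u := hu.apply_eq_smul
  have h' : S u = c • T u := by
    rw [LinearEquiv.symm_apply_eq, map_smul] at h
    exact h
  simp [h']

end GK

/-- The Gelfand–Kazhdan condition implies that `(G,H)` is a Gelfand pair and
every `H`-distinguished irreducible representation satisfies `π ∘ θ ≅ π*`. -/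
theorem gelfand_and_selfdual_of_GK {G : Type} [Group G] [Fintype G]
    (θ : G ≃* G) (hθ : ∀ g : G, θ (θ g) = g)
    (H : Subgroup G) (hH : H.map θ.toMonoidHom = H)
    (hGK : ∀ g : G, ∃ h₁ ∈ H, ∃ h₂ ∈ H, h₁ * g⁻¹ * h₂ = θ g) :
    GK.IsGelfandPair G H ∧
      ∀ (V : Type) [AddCommGroup V] [Module ℂ V] [FiniteDimensional ℂ V]
        (π : Representation ℂ G V), GK.IsIrred π → GK.invariantsOf π H ≠ ⊥ →
          GK.ConjThetaIsoDual θ π := by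
  refine ⟨fun V _ _ _ π hπ => ?_, fun V _ _ _ π hπ hne => ?_⟩
  · by_cases hbot : GK.invariantsOf π H = ⊥
    · rw [hbot, finrank_bot]; exact zero_le_one
    obtain ⟨v, hvH, hv⟩ := Submodule.exists_mem_ne_zero_of_ne_bot hbot
    obtain ⟨l, hl, hlv⟩ := GK.exists_invariant_functional H hvH hv
    obtain ⟨T, hTv, hT⟩ := GK.exists_intertwiner_dual hGK hπ hvH hv hl
    have hT0 : T ≠ 0 := fun h => hlv (by simp [← hTv, h])
    refine finrank_le_one (⟨v, hvH⟩ : GK.invariantsOf π H) fun w => ⟨l w / l v, ?_⟩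
    by_contra hw
    obtain ⟨m, hm, hmw⟩ := GK.exists_invariant_functional H
      (sub_mem w.2 (Submodule.smul_mem _ (l w / l v) hvH))
      (sub_ne_zero.2 fun h => hw (Subtype.ext h.symm))
    obtain ⟨S, hSv, hS⟩ := GK.exists_intertwiner_dual hGK hπ hvH hv hm
    obtain ⟨c, hc⟩ := GK.exists_eq_smul_intertwiner_dual hπ hS hT hT0
    have hml : m = c • l := by rw [← hSv, ← hTv, hc, LinearMap.smul_apply]
    exact hmw (by simp [hml, hlv])
  · obtain ⟨v, hvH, hv⟩ := Submodule.exists_mem_ne_zero_of_ne_bot hne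
    obtain ⟨l, hl, hlv⟩ := GK.exists_invariant_functional H hvH hv
    obtain ⟨T, hTv, hT⟩ := GK.exists_intertwiner_dual hGK hπ hvH hv hl
    have hT0 : T ≠ 0 := fun h => hlv (by simp [← hTv, h])
    exact ⟨LinearEquiv.ofBijective T (GK.bijective_intertwiner_dual hπ hT hT0), hT⟩
end
end
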